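/- For every integer m ≥ 1, the real symmetric m×m matrix M with rows and columns indexed by 1,…,m, whose entries are M_{ii} = 2 − 1/i on the diagonal and M_{ij} = −1/(|i−j|(|i−j|+1)) for i ≠ j, is positive definite. -/

import Mathlib

/-- The symmetric matrix `T_m H + H T_mᵀ - H` (rows/columns indexed by `1,…,m`,
realized on `Fin m` via `i ↦ i+1`): diagonal entries `2 - 1/i`, off-diagonal
entries `-1/(|i-j|(|i-j|+1))`. -/
noncomputable def Mmat (m : ℕ) : Matrix (Fin m) (Fin m) ℝ :=
  Matrix.of fun i j =>
    if i = j then 2 - 1 / ((i : ℕ) + 1 : ℝ)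
    else -(1 / (|((i : ℕ) : ℝ) - ((j : ℕ) : ℝ)| * (|((i : ℕ) : ℝ) - ((j : ℕ) : ℝ)| + 1)))

/-- The distance kernel `1 / (|i - j| (|i - j| + 1))` (zero on the diagonal) summed over `j < n`,
for `n ≤ i`. -/
theorem sum_range_kernel_of_le (i n : ℕ) (h : n ≤ i) :
    ∑ j ∈ Finset.range n, 1 / (|(i : ℝ) - j| * (|(i : ℝ) - j| + 1)) =
      1 / ((i : ℝ) - n + 1) - 1 / ((i : ℝ) + 1) := by
  induction n with
  | zero => simp
  | succ n ih =>
    have hn : (n : ℝ) + 1 ≤ i := by exact_mod_cast h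
    have h₁ : (i : ℝ) - n ≠ 0 := by linarith
    have h₂ : (i : ℝ) - n + 1 ≠ 0 := by linarith
    rw [Finset.sum_range_succ, ih (by omega), abs_of_pos (by linarith), Nat.cast_succ,
      show (i : ℝ) - (n + 1) + 1 = i - n by ring]
    field_simp
    ring

/-- The distance kernel `1 / (|i - j| (|i - j| + 1))` (zero on the diagonal) summed over `j < n`,
for `i < n`. -/
theorem sum_range_kernel_of_lt (i n : ℕ) (h : i + 1 ≤ n) :
    ∑ j ∈ Finset.range n, 1 / (|(i : ℝ) - j| * (|(i : ℝ) - j| + 1)) =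
      2 - 1 / ((i : ℝ) + 1) - 1 / ((n : ℝ) - i) := by
  induction n, h using Nat.le_induction with
  | base =>
    rw [Finset.sum_range_succ, sum_range_kernel_of_le i i le_rfl]
    simp
    ring
  | succ n h ih =>
    have hn : (i : ℝ) + 1 ≤ n := by exact_mod_cast h
    have h₁ : (n : ℝ) - i ≠ 0 := by linarith
    have h₂ : (n : ℝ) - i + 1 ≠ 0 := by linarith
    rw [Finset.sum_range_succ, ih, abs_of_neg (by linarith), Nat.cast_succ, neg_sub,
      show (n : ℝ) + 1 - i = n - i + 1 by ring]
    field_simp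
    ring

/-- A real symmetric matrix whose diagonal entries strictly dominate their rows is positive
definite. -/
theorem Matrix.IsHermitian.posDef_of_sum_row_lt_diag {n : Type*} [Fintype n] [DecidableEq n]
    {A : Matrix n n ℝ} (hA : A.IsHermitian)
    (h : ∀ k, ∑ j ∈ Finset.univ.erase k, ‖A k j‖ < A k k) : A.PosDef := by
  rw [hA.posDef_iff_eigenvalues_pos]
  intro i
  have hμ : Module.End.HasEigenvalue (Matrix.toLin' A) (hA.eigenvalues i) := by
    rw [Module.End.hasEigenvalue_iff_mem_spectrum, Matrix.spectrum_toLin']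
    exact hA.eigenvalues_mem_spectrum_real i
  obtain ⟨k, hk⟩ := eigenvalue_mem_ball hμ
  rw [Metric.mem_closedBall, Real.dist_eq] at hk
  linarith [h k, neg_abs_le (hA.eigenvalues i - A k k)]

theorem M_posdef (m : ℕ) (hm : 1 ≤ m) : (Mmat m).PosDef := by
  refine Matrix.IsHermitian.posDef_of_sum_row_lt_diag ?_ fun k => ?_
  · ext i j
    simp only [Mmat, Matrix.conjTranspose_apply, Matrix.of_apply, star_trivial, eq_comm (a := j),
      abs_sub_comm (j : ℝ)]
    split_ifs with h
    · rw [h]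
    · rfl
  · have hrow : ∑ j ∈ Finset.univ.erase k, ‖Mmat m k j‖ =
        ∑ j ∈ Finset.range m, 1 / (|((k : ℕ) : ℝ) - j| * (|((k : ℕ) : ℝ) - j| + 1)) := by
      rw [← Fin.sum_univ_eq_sum_range
        (fun j => 1 / (|((k : ℕ) : ℝ) - j| * (|((k : ℕ) : ℝ) - j| + 1))),
        ← Finset.sum_erase (a := k) Finset.univ (by simp)]
      refine Finset.sum_congr rfl fun j hj => ?_
      rw [Mmat, Matrix.of_apply, if_neg (Finset.ne_of_mem_erase hj).symm, norm_neg,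
        Real.norm_of_nonneg (by positivity)]
    have hk : ((k : ℕ) : ℝ) < m := by exact_mod_cast k.isLt
    have hpos : 0 < 1 / ((m : ℝ) - (k : ℕ)) := one_div_pos.mpr (sub_pos.mpr hk)
    rw [hrow, sum_range_kernel_of_lt k m k.isLt, Mmat, Matrix.of_apply, if_pos rfl]
    linarith
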